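/- Suppose Assumption (H) holds. Let S ≥ 0 and R, r > 0 be given. Then there exists a constant L > 0 (depending only on S, R, r and ρ*) such that for every a, b ∈ ℝ with a < b, every positive continuous function ρ on [a,b] belonging to H¹(a,b), and every continuous function v on [a,b] belonging to H¹(a,b), with ∫_a^b ρ(x)dx = 1 and V(a,b,ρ,v) ≤ S, the following inequality holds: V(a,b,ρ,v) ≤ L ∫_a^b P'(ρ(x)) (μ(ρ(x))ρ(x)^{-1}ρ_x(x))² dx + L r ∫_a^b μ(ρ(x)) v_x²(x) dx + L R min( ((r+1)v(a) + k(ρ(a)))², v²(a) ) + L k(ρ(b))(P(ρ(b)) − P_ext) + (L/2) k(ρ(a))(P(ρ(a)) − P_ext). -/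

import Mathlib

open MeasureTheory Set Filter

/-- `Q(ρ) = ρ ∫_{ρ*}^{ρ} P(τ)/τ² dτ − (P(ρ*)/ρ*)ρ + P(ρ*)`. -/
noncomputable def Qf (P : ℝ → ℝ) (ρs x : ℝ) : ℝ :=
  x * (∫ τ in ρs..x, P τ / τ ^ 2) - (P ρs / ρs) * x + P ρs

/-- `k(ρ) = ∫_{ρ*}^{ρ} μ(τ)/τ dτ`. -/
noncomputable def kf (μ : ℝ → ℝ) (ρs x : ℝ) : ℝ :=
  ∫ τ in ρs..x, μ τ / τ

/-- `G(ρ) = ∫_{ρ*}^{ρ} μ(l) l^{-3/2} √(Q(l)) dl`. -/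
noncomputable def Gf (P μ : ℝ → ℝ) (ρs x : ℝ) : ℝ :=
  ∫ l in ρs..x, μ l / l ^ ((3 : ℝ) / 2) * Real.sqrt (Qf P ρs l)

/-- Assumption (H): `G(ρ) → +∞` as `ρ → +∞`, `G(ρ) → −∞` as `ρ → 0⁺`,
and `k(ρ) → +∞` as `ρ → +∞`. -/
def AssumpH (P μ : ℝ → ℝ) (ρs : ℝ) : Prop :=
  Tendsto (Gf P μ ρs) atTop atTop ∧
  Tendsto (Gf P μ ρs) (nhdsWithin 0 (Ioi 0)) atBot ∧
  Tendsto (kf μ ρs) atTop atTop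

/-- Potential energy `U(a,b,ρ) = ∫_a^b Q(ρ(x)) dx`. -/
noncomputable def Uf (P : ℝ → ℝ) (ρs a b : ℝ) (ρ : ℝ → ℝ) : ℝ :=
  ∫ x in a..b, Qf P ρs (ρ x)

/-- Total mechanical energy `E`. -/
noncomputable def Ef (P : ℝ → ℝ) (ρs a b : ℝ) (ρ v : ℝ → ℝ) : ℝ :=
  (v a) ^ 2 / 2 + (v b) ^ 2 / 2 + (1 / 2) * (∫ x in a..b, ρ x * (v x) ^ 2)
    + Uf P ρs a b ρ

/-- Transformed energy `W`. -/
noncomputable def Wf (P μ : ℝ → ℝ) (ρs a b : ℝ) (ρ ρx v : ℝ → ℝ) : ℝ :=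
  (1 / 2) * (∫ x in a..b, (ρ x)⁻¹ * (ρ x * v x + μ (ρ x) * (ρ x)⁻¹ * ρx x) ^ 2)
    + (1 / 2) * (v b - kf μ ρs (ρ b)) ^ 2
    + (1 / 2) * (v a + kf μ ρs (ρ a)) ^ 2
    + Uf P ρs a b ρ

/-- Control Lyapunov functional `V = W + r E`. -/
noncomputable def Vf (P μ : ℝ → ℝ) (ρs r a b : ℝ) (ρ ρx v : ℝ → ℝ) : ℝ :=
  Wf P μ ρs a b ρ ρx v + r * Ef P ρs a b ρ v

/-- `f ∈ H¹(a,b)` with weak derivative `f'`:  `f' ∈ L¹ ∩ L²(a,b)` and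
`f(x) = f(a) + ∫_a^x f'(s) ds` on `[a,b]`. -/
def H1On (a b : ℝ) (f f' : ℝ → ℝ) : Prop :=
  IntervalIntegrable f' volume a b ∧
  IntervalIntegrable (fun s => (f' s) ^ 2) volume a b ∧
  ∀ x ∈ Icc a b, f x = f a + ∫ s in a..x, f' s


lemma ac_comp_aux {F G : ℝ → ℝ} {a b : ℝ} {K : ℝ} (hK : 0 ≤ K)
    (hF : AbsolutelyContinuousOnInterval F a b)
    (hG : ∀ x ∈ uIcc a b, ∀ y ∈ uIcc a b, |G (F x) - G (F y)| ≤ K * |F x - F y|) :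
    AbsolutelyContinuousOnInterval (fun x => G (F x)) a b := by
  rw [absolutelyContinuousOnInterval_iff] at hF ⊢
  intro ε hε
  obtain ⟨δ, hδ, h⟩ := hF (ε / (K + 1)) (by positivity)
  refine ⟨δ, hδ, fun E hE hE2 => ?_⟩
  have h1 := h E hE hE2
  calc _ ≤ ∑ i ∈ Finset.range E.1, K * dist (F (E.2 i).1) (F (E.2 i).2) := by
        apply Finset.sum_le_sum
        intro i hi
        rw [Real.dist_eq, Real.dist_eq]
        exact hG _ (hE.left i hi).left _ (hE.left i hi).right
    _ = K * ∑ i ∈ Finset.range E.1, dist (F (E.2 i).1) (F (E.2 i).2) := (Finset.mul_sum _ _ _).symm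
    _ ≤ K * (ε / (K + 1)) := by gcongr
    _ < (K + 1) * (ε / (K + 1)) := by gcongr; linarith
    _ = ε := by field

lemma bd_above {f : ℝ → ℝ} (hf : ContinuousOn f (Ioi 0)) {m M : ℝ} (hm : 0 < m) :
    ∃ C, 0 < C ∧ ∀ x ∈ Icc m M, |f x| ≤ C := by
  have h1 : ContinuousOn f (Icc m M) := hf.mono fun x hx => lt_of_lt_of_le hm hx.1
  obtain ⟨C, hC⟩ := isCompact_Icc.exists_bound_of_continuousOn h1
  refine ⟨max C 1, by positivity, fun x hx => (hC x hx).trans (le_max_left _ _)⟩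

lemma bd_below {f : ℝ → ℝ} (hf : ContinuousOn f (Ioi 0)) (hp : ∀ x, 0 < x → 0 < f x)
    {m M : ℝ} (hm : 0 < m) :
    ∃ c, 0 < c ∧ ∀ x ∈ Icc m M, c ≤ f x := by
  have hi : ContinuousOn (fun x => (f x)⁻¹) (Ioi 0) := hf.inv₀ fun x hx => (hp x hx).ne'
  obtain ⟨C, hC, h⟩ := bd_above hi (M := M) hm
  refine ⟨C⁻¹, by positivity, fun x hx => ?_⟩
  have h1 := hp x (lt_of_lt_of_le hm hx.1)
  have h2 := (le_abs_self _).trans (h x hx)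
  exact inv_le_of_inv_le₀ h1 h2

lemma chain_aux {a b : ℝ} (hab : a ≤ b) {ρ ρx G g : ℝ → ℝ}
    (hc : ContinuousOn ρ (Icc a b)) (hpos : ∀ x ∈ Icc a b, 0 < ρ x) (h : H1On a b ρ ρx)
    (hG : ∀ x, 0 < x → HasDerivAt G (g x) x) (hg : ContinuousOn g (Ioi 0))
    {c d : ℝ} (hcm : c ∈ Icc a b) (hdm : d ∈ Icc a b) :
    G (ρ d) - G (ρ c) = ∫ x in c..d, g (ρ x) * ρx x := by
  obtain ⟨h1, h2, h3⟩ := h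
  have hu : uIcc a b = Icc a b := uIcc_of_le hab
  have hsub : uIcc c d ⊆ uIcc a b := by
    rw [hu]; exact OrdConnected.uIcc_subset ordConnected_Icc hcm hdm
  set F : ℝ → ℝ := fun x => ρ a + ∫ s in a..x, ρx s with hFdef
  have hFe : ∀ x ∈ Icc a b, ρ x = F x := h3
  have hFac : AbsolutelyContinuousOnInterval F a b := by
    have e1 := h1.absolutelyContinuousOnInterval_intervalIntegral (c := a) (by simp)
    have e2 : AbsolutelyContinuousOnInterval (fun _ : ℝ => ρ a) a b :=
      (LipschitzWith.const (ρ a)).lipschitzOnWith.absolutelyContinuousOnInterval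
    exact e2.add e1
  obtain ⟨x0, hx0, hmin⟩ := isCompact_Icc.exists_isMinOn (nonempty_Icc.2 hab) hc
  obtain ⟨x1, hx1, hmax⟩ := isCompact_Icc.exists_isMaxOn (nonempty_Icc.2 hab) hc
  have hr : ∀ x ∈ Icc a b, ρ x ∈ Icc (ρ x0) (ρ x1) := fun x hx => ⟨hmin hx, hmax hx⟩
  obtain ⟨K, hK, hKb⟩ := bd_above hg (M := ρ x1) (hpos x0 hx0)
  have hcomp : AbsolutelyContinuousOnInterval (fun x => G (F x)) a b := by
    refine ac_comp_aux hK.le hFac fun x hx y hy => ?_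
    rw [hu] at hx hy
    rw [← hFe x hx, ← hFe y hy]
    have := (convex_Icc (ρ x0) (ρ x1)).norm_image_sub_le_of_norm_hasDerivWithin_le
      (f := G) (f' := g) (C := K)
      (fun z hz => (hG z (lt_of_lt_of_le (hpos x0 hx0) hz.1)).hasDerivWithinAt)
      (fun z hz => hKb z hz) (hr y hy) (hr x hx)
    exact this
  have hfin := (hcomp.mono hsub).integral_deriv_eq_sub
  rw [hFe c hcm, hFe d hdm, ← hfin]
  apply intervalIntegral.integral_congr_ae
  filter_upwards [h1.ae_hasDerivAt_integral] with x hx hx2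
  have hxm : x ∈ uIcc a b := hsub (uIoc_subset_uIcc hx2)
  have hd := hx hxm a (by simp)
  have hxm' := hxm
  rw [hu] at hxm'
  have hFd : HasDerivAt F (ρx x) x := hd.const_add (ρ a)
  have hGd : HasDerivAt G (g (ρ x)) (F x) := by
    rw [← hFe x hxm']; exact hG _ (hpos x hxm')
  exact (hGd.comp x hFd).deriv

lemma cs_aux {a b : ℝ} (hab : a < b) {f f' : ℝ → ℝ} (h : H1On a b f f') {x : ℝ}
    (hx : x ∈ Icc a b) :
    (f x - f a) ^ 2 ≤ (b - a) * ∫ s in a..b, (f' s) ^ 2 := by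
  obtain ⟨h1, h2, h3⟩ := h
  have hN : 0 ≤ ∫ s in a..b, (f' s) ^ 2 :=
    intervalIntegral.integral_nonneg hab.le fun s _ => sq_nonneg _
  rw [h3 x hx]
  rcases hx.1.eq_or_lt with rfl | hax
  · simp only [intervalIntegral.integral_same]
    nlinarith
  have hsub : uIcc a x ⊆ uIcc a b := by
    rw [uIcc_of_le hab.le, uIcc_of_le hx.1]; exact Icc_subset_Icc le_rfl hx.2
  have g1 := h1.mono_set hsub
  have g2 := h2.mono_set hsub
  set I := ∫ s in a..x, f' s with hI
  set N := ∫ s in a..x, (f' s) ^ 2 with hNd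
  have hNle : N ≤ ∫ s in a..b, (f' s) ^ 2 := by
    apply intervalIntegral.integral_mono_interval le_rfl hx.1 hx.2 _ h2
    exact Eventually.of_forall fun s => sq_nonneg _
  have hNx : 0 ≤ N := intervalIntegral.integral_nonneg hax.le fun s _ => sq_nonneg _
  have key : 0 ≤ ∫ s in a..x, ((x - a) ^ 2 * (f' s) ^ 2 - 2 * I * (x - a) * f' s + I ^ 2) := by
    apply intervalIntegral.integral_nonneg hax.le
    intro s _
    nlinarith [sq_nonneg ((x - a) * f' s - I)]
  rw [intervalIntegral.integral_add ((g2.const_mul _).sub (g1.const_mul _)) (by simp),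
    intervalIntegral.integral_sub (g2.const_mul _) (g1.const_mul _),
    intervalIntegral.integral_const_mul, intervalIntegral.integral_const_mul,
    intervalIntegral.integral_const, ← hI, ← hNd, smul_eq_mul] at key
  have hxa : 0 < x - a := by linarith
  have h5 : 0 ≤ (x - a) * ((x - a) * N - I ^ 2) := by nlinarith
  have h6 : 0 ≤ (x - a) * N - I ^ 2 := nonneg_of_mul_nonneg_right h5 hxa
  have h7 : (x - a) * N ≤ (b - a) * ∫ s in a..b, (f' s) ^ 2 :=
    mul_le_mul (by linarith [hx.2]) hNle hNx (by linarith)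
  nlinarith

lemma deriv_prim {f : ℝ → ℝ} (hf : ContinuousOn f (Ioi 0)) {s x : ℝ} (hs : 0 < s) (hx : 0 < x) :
    HasDerivAt (fun y => ∫ t in s..y, f t) (f x) x := by
  have hsub : uIcc s x ⊆ Ioi 0 := OrdConnected.uIcc_subset ordConnected_Ioi hs hx
  apply intervalIntegral.integral_hasDerivAt_right (hf.mono hsub).intervalIntegrable
  · exact hf.stronglyMeasurableAtFilter isOpen_Ioi x hx
  · exact hf.continuousAt (Ioi_mem_nhds hx)

noncomputable def Hf (P : ℝ → ℝ) (ρs x : ℝ) : ℝ := ∫ τ in ρs..x, (P τ - P ρs) / τ ^ 2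

lemma contH {P : ℝ → ℝ} {c : ℝ} (hc : ContinuousOn P (Ioi 0)) :
    ContinuousOn (fun τ => (P τ - c) / τ ^ 2) (Ioi 0) :=
  (hc.sub continuousOn_const).div (continuousOn_id.pow 2) fun x hx => (pow_pos hx 2).ne'

lemma Qf_eq {P : ℝ → ℝ} {ρs x : ℝ} (hc : ContinuousOn P (Ioi 0)) (hs : 0 < ρs) (hx : 0 < x) :
    Qf P ρs x = x * Hf P ρs x := by
  have hsub : uIcc ρs x ⊆ Ioi 0 := OrdConnected.uIcc_subset ordConnected_Ioi hs hx
  have i1 : IntervalIntegrable (fun τ => P τ / τ ^ 2) volume ρs x := by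
    have := (contH (c := 0) hc).mono hsub
    simp only [sub_zero] at this
    exact this.intervalIntegrable
  have hcc : ContinuousOn (fun τ : ℝ => P ρs / τ ^ 2) (Ioi 0) :=
    continuousOn_const.div (continuousOn_id.pow 2) fun x hx => (pow_pos hx 2).ne'
  have i2 : IntervalIntegrable (fun τ : ℝ => P ρs / τ ^ 2) volume ρs x :=
    (hcc.mono hsub).intervalIntegrable
  have e : ∫ τ in ρs..x, P ρs / τ ^ 2 = -(P ρs / x) - -(P ρs / ρs) := by
    apply intervalIntegral.integral_eq_sub_of_hasDerivAt (f := fun y => -(P ρs / y)) _ i2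
    intro y hy
    have hy0 : 0 < y := hsub hy
    have := ((hasDerivAt_inv hy0.ne').const_mul (P ρs)).neg
    have e : P ρs / y ^ 2 = -(P ρs * -(y ^ 2)⁻¹) := by ring
    rw [e]
    refine this.congr_of_eventuallyEq (Eventually.of_forall fun z => ?_)
    simp [div_eq_mul_inv]
  unfold Qf Hf
  simp only [sub_div]
  rw [intervalIntegral.integral_sub i1 i2, e]
  field_simp
  ring

lemma Hf_deriv {P : ℝ → ℝ} {ρs x : ℝ} (hc : ContinuousOn P (Ioi 0)) (hs : 0 < ρs) (hx : 0 < x) :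
    HasDerivAt (Hf P ρs) ((P x - P ρs) / x ^ 2) x := deriv_prim (contH hc) hs hx

lemma Hf_nonneg {P : ℝ → ℝ} {ρs x : ℝ} (hm : MonotoneOn P (Ioi 0)) (hs : 0 < ρs) (hx : 0 < x) : 0 ≤ Hf P ρs x := by
  unfold Hf
  rcases le_total ρs x with h | h
  · apply intervalIntegral.integral_nonneg h
    intro u hu
    have : P ρs ≤ P u := hm hs (lt_of_lt_of_le hs hu.1) hu.1
    exact div_nonneg (by linarith) (by positivity)
  · rw [intervalIntegral.integral_symm, ← intervalIntegral.integral_neg]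
    apply intervalIntegral.integral_nonneg h
    intro u hu
    have : P u ≤ P ρs := hm (lt_of_lt_of_le hx hu.1) hs hu.2
    rw [← neg_div]
    exact div_nonneg (by linarith) (by positivity)

lemma Hf_small {P : ℝ → ℝ} {ρs : ℝ} (hc : ContinuousOn P (Ioi 0))
    (hm : StrictMonoOn P (Ioi 0)) (hs : 0 < ρs) (T : ℝ) :
    ∃ ε, 0 < ε ∧ ∀ x, 0 < x → Hf P ρs x ≤ T → ε ≤ x := by
  have h2 : 0 < ρs / 2 := by positivity
  set δ := P ρs - P (ρs / 2) with hδ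
  have hδ0 : 0 < δ := by
    have := hm (show ρs / 2 ∈ Ioi 0 from h2) (show ρs ∈ Ioi 0 from hs) (by linarith)
    linarith
  have anti : AntitoneOn (fun x => Hf P ρs x - δ * x⁻¹) (Ioc 0 (ρs / 2)) := by
    have hd : ∀ x, 0 < x → HasDerivAt (fun x => Hf P ρs x - δ * x⁻¹)
        ((P x - P ρs) / x ^ 2 - δ * (-(x ^ 2)⁻¹)) x := fun x hx =>
      (Hf_deriv hc hs hx).sub ((hasDerivAt_inv hx.ne').const_mul δ)
    apply antitoneOn_of_deriv_nonpos (convex_Ioc _ _)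
    · exact fun x hx => (hd x hx.1).continuousAt.continuousWithinAt
    · intro x hx
      rw [interior_Ioc] at hx
      exact (hd x hx.1).differentiableAt.differentiableWithinAt
    · intro x hx
      rw [interior_Ioc] at hx
      rw [(hd x hx.1).deriv]
      have h3 : P x ≤ P (ρs / 2) := hm.monotoneOn hx.1 h2 hx.2.le
      have h4 : (P x - P ρs) / x ^ 2 - δ * (-(x ^ 2)⁻¹) = (P x - P (ρs / 2)) / x ^ 2 := by
        rw [hδ]; ring
      rw [h4]
      exact div_nonpos_of_nonpos_of_nonneg (by linarith) (by positivity)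
  set B := |T| / δ + (ρs / 2)⁻¹ with hB
  have hB0 : 0 < B := by positivity
  refine ⟨min (ρs / 2) B⁻¹, by positivity, fun x hx hT => ?_⟩
  rcases le_total (ρs / 2) x with h | h
  · exact (min_le_left _ _).trans h
  · refine (min_le_right _ _).trans ?_
    have h5 := anti (show x ∈ Ioc 0 (ρs / 2) from ⟨hx, h⟩) ⟨h2, le_rfl⟩ h
    simp only at h5
    have h6 := Hf_nonneg hm.monotoneOn hs h2
    have h7 : δ * x⁻¹ ≤ δ * B := by
      have : δ * B = |T| + δ * (ρs / 2)⁻¹ := by rw [hB]; field_simp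
      rw [this]
      linarith [le_abs_self T]
    have h8 : x⁻¹ ≤ B := le_of_mul_le_mul_left h7 hδ0
    exact inv_le_of_inv_le₀ hx h8

/-- pointwise estimates on a compact range -/
lemma pointwise_aux {P μ P' : ℝ → ℝ} {ρs m M : ℝ}
    (hPc : ContinuousOn P (Ioi 0)) (hP'c : ContinuousOn P' (Ioi 0)) (hμc : ContinuousOn μ (Ioi 0))
    (hμpos : ∀ x, 0 < x → 0 < μ x)
    (hP' : ∀ x, 0 < x → HasDerivAt P (P' x) x)
    (hP'pos : ∀ x, 0 < x → 0 < P' x) (hm : 0 < m) (hms : m ≤ ρs) (hMs : ρs ≤ M) :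
    ∃ c C : ℝ, 0 < c ∧ 0 < C ∧ ∀ x ∈ Icc m M,
      c * x⁻¹ ≤ P' x ∧ c ≤ μ x ∧ kf μ ρs x ^ 2 ≤ C * (x - ρs) ^ 2 ∧
      c * (x - ρs) ^ 2 ≤ kf μ ρs x * (P x - P ρs) ∧
      Qf P ρs x ≤ C * (x - ρs) ^ 2 ∧ 1 ≤ C * (x⁻¹ * (μ x * x⁻¹) ^ 2) := by
  have hs : 0 < ρs := lt_of_lt_of_le hm hms
  have hsm : ρs ∈ Icc m M := ⟨hms, hMs⟩
  have hinv : ContinuousOn (fun x : ℝ => x⁻¹) (Ioi 0) :=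
    continuousOn_id.inv₀ fun x hx => (show (0 : ℝ) < x from hx).ne'
  have hκc : ContinuousOn (fun x => μ x / x) (Ioi 0) := by
    simp only [div_eq_mul_inv]; exact hμc.mul hinv
  have hκpos : ∀ x, 0 < x → 0 < μ x / x := fun x hx => div_pos (hμpos x hx) hx
  have hpos : ∀ x ∈ Icc m M, 0 < x := fun x hx => lt_of_lt_of_le hm hx.1
  obtain ⟨p0, hp0, hp0'⟩ := bd_below hP'c hP'pos (M := M) hm
  obtain ⟨p1, hp1, hp1'⟩ := bd_above hP'c (M := M) hm
  obtain ⟨k0, hk0, hk0'⟩ := bd_below hκc hκpos (M := M) hm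
  obtain ⟨k1, hk1, hk1'⟩ := bd_above hκc (M := M) hm
  obtain ⟨m0, hm0, hm0'⟩ := bd_below hμc hμpos (M := M) hm
  obtain ⟨q0, hq0, hq0'⟩ := bd_below (f := fun x => x⁻¹ * (μ x * x⁻¹) ^ 2)
    (hinv.mul ((hμc.mul hinv).pow 2))
    (fun x hx => by have := hμpos x hx; positivity) (M := M) hm
  have hkd : ∀ x, 0 < x → HasDerivAt (kf μ ρs) (μ x / x) x := fun x hx => deriv_prim hκc hs hx
  have hks : kf μ ρs ρs = 0 := by simp [kf]
  have low : ∀ (f f' : ℝ → ℝ) (c0 : ℝ), (∀ x, 0 < x → HasDerivAt f (f' x) x) →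
      (∀ x ∈ Icc m M, c0 ≤ f' x) → ∀ x ∈ Icc m M, ∀ y ∈ Icc m M, x ≤ y →
      c0 * (y - x) ≤ f y - f x := by
    intro f f' c0 hd hle
    apply (convex_Icc m M).mul_sub_le_image_sub_of_le_deriv
    · exact fun x hx => (hd x (hpos x hx)).continuousAt.continuousWithinAt
    · exact fun x hx => (hd x (hpos x (interior_subset hx))).differentiableAt.differentiableWithinAt
    · intro x hx
      rw [(hd x (hpos x (interior_subset hx))).deriv]
      exact hle x (interior_subset hx)
  have up : ∀ (f f' : ℝ → ℝ) (c0 : ℝ), (∀ x, 0 < x → HasDerivAt f (f' x) x) →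
      (∀ x ∈ Icc m M, |f' x| ≤ c0) → ∀ x ∈ Icc m M, ∀ y ∈ Icc m M,
      |f y - f x| ≤ c0 * |y - x| := by
    intro f f' c0 hd hle x hx y hy
    exact (convex_Icc m M).norm_image_sub_le_of_norm_hasDerivWithin_le
      (fun z hz => (hd z (hpos z hz)).hasDerivWithinAt) hle hx hy
  set C := k1 ^ 2 + M * (p1 / m ^ 2) + q0⁻¹ with hC
  have hM : 0 < M := lt_of_lt_of_le hs hMs
  have hA1 : 0 < M * (p1 / m ^ 2) := by positivity
  have hA2 : 0 < q0⁻¹ := by positivity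
  have hA3 : 0 < k1 ^ 2 := by positivity
  refine ⟨min (min (p0 * m) m0) (k0 * p0), C, by positivity, by positivity, fun x hx => ?_⟩
  have hx0 := hpos x hx
  refine ⟨?_, ?_, ?_, ?_, ?_, ?_⟩
  · have h1 : min (min (p0 * m) m0) (k0 * p0) ≤ p0 * m := (min_le_left _ _).trans (min_le_left _ _)
    calc _ ≤ p0 * m * x⁻¹ := by gcongr
      _ = p0 * (m / x) := by ring
      _ ≤ p0 * 1 := by
        gcongr
        exact (div_le_one hx0).2 hx.1
      _ ≤ P' x := by rw [mul_one]; exact hp0' x hx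
  · exact ((min_le_left _ _).trans (min_le_right _ _)).trans (hm0' x hx)
  · have := up _ _ k1 hkd hk1' ρs hsm x hx
    rw [hks, sub_zero] at this
    have h2 : |kf μ ρs x| ^ 2 ≤ (k1 * |x - ρs|) ^ 2 := by gcongr
    rw [mul_pow, sq_abs, sq_abs] at h2
    refine h2.trans ?_
    gcongr
    linarith
  · have hle : min (min (p0 * m) m0) (k0 * p0) ≤ k0 * p0 := min_le_right _ _
    have h1 : k0 * p0 * (x - ρs) ^ 2 ≤ kf μ ρs x * (P x - P ρs) := by
      rcases le_total ρs x with h | h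
      · have e1 := low _ _ k0 hkd hk0' ρs hsm x hx h
        have e2 := low _ _ p0 hP' hp0' ρs hsm x hx h
        rw [hks, sub_zero] at e1
        have := mul_le_mul e1 e2 (mul_nonneg hp0.le (by linarith))
          (le_trans (mul_nonneg hk0.le (by linarith)) e1)
        linarith
      · have e1 := low _ _ k0 hkd hk0' x hx ρs hsm h
        have e2 := low _ _ p0 hP' hp0' x hx ρs hsm h
        rw [hks, zero_sub] at e1
        have := mul_le_mul e1 e2 (mul_nonneg hp0.le (by linarith))
          (le_trans (mul_nonneg hk0.le (by linarith)) e1)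
        linarith
    refine le_trans ?_ h1
    gcongr
  · rw [Qf_eq hPc hs hx0]
    have hI : ‖Hf P ρs x‖ ≤ (p1 / m ^ 2 * |x - ρs|) * |x - ρs| := by
      unfold Hf
      apply intervalIntegral.norm_integral_le_of_norm_le_const
      intro y hy
      have hy' : y ∈ uIcc ρs x := uIoc_subset_uIcc hy
      have hym : y ∈ Icc m M := (OrdConnected.uIcc_subset ordConnected_Icc hsm hx) hy'
      have e1 := up _ _ p1 hP' hp1' ρs hsm y hym
      have e2 : |y - ρs| ≤ |x - ρs| := by
        have := abs_sub_left_of_mem_uIcc hy'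
        simpa using this
      rw [Real.norm_eq_abs, abs_div, abs_of_pos (by have := hpos y hym; positivity : 0 < y ^ 2)]
      calc |P y - P ρs| / y ^ 2 ≤ (p1 * |x - ρs|) / m ^ 2 := by
            gcongr
            · exact e1.trans (by gcongr)
            · exact hym.1
        _ = _ := by ring
    have h1 : Hf P ρs x ≤ p1 / m ^ 2 * (x - ρs) ^ 2 := by
      refine (le_abs_self _).trans (hI.trans (le_of_eq ?_))
      rw [← sq_abs (x - ρs)]; ring
    calc x * Hf P ρs x ≤ x * (p1 / m ^ 2 * (x - ρs) ^ 2) := by gcongr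
      _ ≤ M * (p1 / m ^ 2 * (x - ρs) ^ 2) := by gcongr; exact hx.2
      _ = M * (p1 / m ^ 2) * (x - ρs) ^ 2 := by ring
      _ ≤ C * (x - ρs) ^ 2 := by gcongr; linarith
  · have h1 := hq0' x hx
    calc (1 : ℝ) = q0⁻¹ * q0 := by field_simp
      _ ≤ C * (x⁻¹ * (μ x * x⁻¹) ^ 2) := by
        apply mul_le_mul _ h1 hq0.le (by positivity)
        linarith

lemma ints_aux {a b : ℝ} (hab : a < b) {μ ρ ρx v : ℝ → ℝ}
    (hμc : ContinuousOn μ (Ioi 0))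
    (hc : ContinuousOn ρ (Icc a b)) (hpos : ∀ x ∈ Icc a b, 0 < ρ x) (h : H1On a b ρ ρx)
    (hv : ContinuousOn v (Icc a b)) :
    IntervalIntegrable (fun x => (ρ x)⁻¹ * (μ (ρ x) * (ρ x)⁻¹ * ρx x) ^ 2) volume a b ∧
    IntervalIntegrable (fun x => ρ x * (v x) ^ 2) volume a b ∧
    (∫ x in a..b, (ρ x)⁻¹ * (μ (ρ x) * (ρ x)⁻¹ * ρx x) ^ 2) ≤
      2 * (∫ x in a..b, (ρ x)⁻¹ * (ρ x * v x + μ (ρ x) * (ρ x)⁻¹ * ρx x) ^ 2) +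
      2 * (∫ x in a..b, ρ x * (v x) ^ 2) ∧
    (∫ x in a..b, (ρ x)⁻¹ * (ρ x * v x + μ (ρ x) * (ρ x)⁻¹ * ρx x) ^ 2) ≤
      2 * (∫ x in a..b, (ρ x)⁻¹ * (μ (ρ x) * (ρ x)⁻¹ * ρx x) ^ 2) +
      2 * (∫ x in a..b, ρ x * (v x) ^ 2) ∧
    0 ≤ (∫ x in a..b, (ρ x)⁻¹ * (μ (ρ x) * (ρ x)⁻¹ * ρx x) ^ 2) ∧
    0 ≤ (∫ x in a..b, ρ x * (v x) ^ 2) ∧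
    0 ≤ (∫ x in a..b, (ρ x)⁻¹ * (ρ x * v x + μ (ρ x) * (ρ x)⁻¹ * ρx x) ^ 2) := by
  obtain ⟨h1, h2, -⟩ := h
  have hu : uIcc a b = Icc a b := uIcc_of_le hab.le
  have hinv : ContinuousOn (fun x => (ρ x)⁻¹) (Icc a b) := hc.inv₀ fun x hx => (hpos x hx).ne'
  have hμρ : ContinuousOn (fun x => μ (ρ x)) (Icc a b) := hμc.comp hc fun x hx => hpos x hx
  have iJ : IntervalIntegrable (fun x => (ρ x)⁻¹ * (μ (ρ x) * (ρ x)⁻¹ * ρx x) ^ 2) volume a b := by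
    have hk : ContinuousOn (fun x => (ρ x)⁻¹ * (μ (ρ x) * (ρ x)⁻¹) ^ 2) (uIcc a b) := by
      rw [hu]; exact hinv.mul ((hμρ.mul hinv).pow 2)
    refine (h2.continuousOn_mul hk).congr (fun x hx => ?_)
    ring
  have iE : IntervalIntegrable (fun x => ρ x * (v x) ^ 2) volume a b := by
    apply ContinuousOn.intervalIntegrable
    rw [hu]; exact hc.mul (hv.pow 2)
  have iX : IntervalIntegrable (fun x => 2 * v x * (μ (ρ x) * (ρ x)⁻¹) * ρx x) volume a b := by
    apply h1.continuousOn_mul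
    rw [hu]; exact (continuousOn_const.mul hv).mul (hμρ.mul hinv)
  have iI : IntervalIntegrable (fun x => (ρ x)⁻¹ * (ρ x * v x + μ (ρ x) * (ρ x)⁻¹ * ρx x) ^ 2)
      volume a b := by
    refine ((iJ.add iE).add iX).congr (fun x hx => ?_)
    have hx' : x ∈ Icc a b := by rw [← hu]; exact uIoc_subset_uIcc hx
    have := hpos x hx'
    field_simp
    ring
  refine ⟨iJ, iE, ?_, ?_, ?_, ?_, ?_⟩
  · rw [← intervalIntegral.integral_const_mul, ← intervalIntegral.integral_const_mul,
      ← intervalIntegral.integral_add (iI.const_mul 2) (iE.const_mul 2)]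
    apply intervalIntegral.integral_mono_on hab.le iJ ((iI.const_mul 2).add (iE.const_mul 2))
    intro x hx
    have hp := hpos x hx
    generalize μ (ρ x) * (ρ x)⁻¹ * ρx x = w
    have e : 2 * ((ρ x)⁻¹ * (ρ x * v x + w) ^ 2) + 2 * (ρ x * v x ^ 2) - (ρ x)⁻¹ * w ^ 2
        = (ρ x)⁻¹ * (2 * ρ x * v x + w) ^ 2 := by field_simp; ring
    have : 0 ≤ (ρ x)⁻¹ * (2 * ρ x * v x + w) ^ 2 := by positivity
    linarith
  · rw [← intervalIntegral.integral_const_mul, ← intervalIntegral.integral_const_mul,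
      ← intervalIntegral.integral_add (iJ.const_mul 2) (iE.const_mul 2)]
    apply intervalIntegral.integral_mono_on hab.le iI ((iJ.const_mul 2).add (iE.const_mul 2))
    intro x hx
    have hp := hpos x hx
    generalize μ (ρ x) * (ρ x)⁻¹ * ρx x = w
    have e : 2 * ((ρ x)⁻¹ * w ^ 2) + 2 * (ρ x * v x ^ 2) - (ρ x)⁻¹ * (ρ x * v x + w) ^ 2
        = (ρ x)⁻¹ * (ρ x * v x - w) ^ 2 := by field_simp; ring
    have : 0 ≤ (ρ x)⁻¹ * (ρ x * v x - w) ^ 2 := by positivity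
    linarith
  all_goals
    apply intervalIntegral.integral_nonneg hab.le
    intro x hx
    have hp := hpos x hx
    positivity

lemma Qf_cont {P : ℝ → ℝ} {ρs : ℝ} (hPc : ContinuousOn P (Ioi 0)) (hs : 0 < ρs) :
    ContinuousOn (Qf P ρs) (Ioi 0) := by
  have : ContinuousOn (fun x => x * Hf P ρs x) (Ioi 0) := by
    apply continuousOn_id.mul
    exact fun x hx => (Hf_deriv hPc hs hx).continuousAt.continuousWithinAt
  exact this.congr fun x hx => Qf_eq hPc hs hx

set_option maxHeartbeats 1000000 in
lemma range_aux {P μ : ℝ → ℝ} {ρs : ℝ} (hPc : ContinuousOn P (Ioi 0))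
    (hPm : StrictMonoOn P (Ioi 0)) (hμc : ContinuousOn μ (Ioi 0))
    (hμpos : ∀ x, 0 < x → 0 < μ x) (hs : 0 < ρs) (hH : AssumpH P μ ρs)
    (S r : ℝ) (hr : 0 < r) :
    ∃ m M : ℝ, 0 < m ∧ m ≤ ρs ∧ ρs ≤ M ∧
      ∀ (a b : ℝ) (ρ ρx v : ℝ → ℝ), a < b →
        ContinuousOn ρ (Icc a b) → (∀ x ∈ Icc a b, 0 < ρ x) →
        H1On a b ρ ρx → ContinuousOn v (Icc a b) →
        (∫ x in a..b, ρ x) = 1 →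
        Vf P μ ρs r a b ρ ρx v ≤ S → ∀ x ∈ Icc a b, ρ x ∈ Icc m M := by
  obtain ⟨hG1, hG2, hk⟩ := hH
  have hQ0 : ∀ x, 0 < x → 0 ≤ Qf P ρs x := fun x hx => by
    rw [Qf_eq hPc hs hx]; exact mul_nonneg hx.le (Hf_nonneg hPm.monotoneOn hs hx)
  have hQc := Qf_cont hPc hs
  set g : ℝ → ℝ := fun l => μ l / l ^ ((3 : ℝ) / 2) * Real.sqrt (Qf P ρs l) with hg
  have hgc : ContinuousOn g (Ioi 0) := by
    apply ContinuousOn.mul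
    · apply hμc.div
      · exact continuousOn_id.rpow_const fun x hx => Or.inl (show (0 : ℝ) < x from hx).ne'
      · exact fun x hx => (Real.rpow_pos_of_pos hx _).ne'
    · exact hQc.sqrt
  have hg0 : ∀ x, 0 < x → 0 ≤ g x := fun x hx =>
    mul_nonneg (div_nonneg (hμpos x hx).le (Real.rpow_nonneg hx.le _)) (Real.sqrt_nonneg _)
  have hGd : ∀ x, 0 < x → HasDerivAt (Gf P μ ρs) (g x) x := fun x hx => deriv_prim hgc hs hx
  have hGm : MonotoneOn (Gf P μ ρs) (Ioi 0) := by
    apply monotoneOn_of_deriv_nonneg (convex_Ioi 0)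
    · exact fun x hx => (hGd x hx).continuousAt.continuousWithinAt
    · intro x hx
      rw [interior_Ioi] at hx
      exact (hGd x hx).differentiableAt.differentiableWithinAt
    · intro x hx
      rw [interior_Ioi] at hx
      rw [(hGd x hx).deriv]; exact hg0 x hx
  set C : ℝ := (4 * S + 4 * (S / r) + S) / 2 with hC
  obtain ⟨M0, hM0⟩ := eventually_atTop.1 (hk.eventually_gt_atTop (1 + 4 * S + 4 * (S / r)))
  obtain ⟨M, hM⟩ := eventually_atTop.1 (hG1.eventually_gt_atTop (Gf P μ ρs (max M0 ρs) + C))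
  obtain ⟨ε, hε, hεH⟩ := Hf_small hPc hPm hs (S + 1)
  have hm := hG2.eventually_lt_atBot (Gf P μ ρs ε - C)
  rw [eventually_nhdsWithin_iff, Metric.eventually_nhds_iff] at hm
  obtain ⟨m, hm0, hm⟩ := hm
  refine ⟨min m ρs, max M ρs, by positivity, min_le_right _ _, le_max_right _ _, ?_⟩
  intro a b ρ ρx v hab hc hpos h hv hmass hV x hx
  obtain ⟨iJ, iE, hJ, hI, hJ0, hE0, hI0⟩ := ints_aux hab hμc hc hpos h hv
  set J := ∫ x in a..b, (ρ x)⁻¹ * (μ (ρ x) * (ρ x)⁻¹ * ρx x) ^ 2 with hJdef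
  set I1 := ∫ x in a..b, ρ x * (v x) ^ 2 with hI1def
  set I2 := ∫ x in a..b, (ρ x)⁻¹ * (ρ x * v x + μ (ρ x) * (ρ x)⁻¹ * ρx x) ^ 2 with hI2def
  have hu : uIcc a b = Icc a b := uIcc_of_le hab.le
  have hQρ : ContinuousOn (fun x => Qf P ρs (ρ x)) (Icc a b) := hQc.comp hc fun x hx => hpos x hx
  have iU : IntervalIntegrable (fun x => Qf P ρs (ρ x)) volume a b := by
    apply ContinuousOn.intervalIntegrable
    rwa [hu]
  have hU0 : 0 ≤ Uf P ρs a b ρ := intervalIntegral.integral_nonneg hab.le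
    fun x hx => hQ0 _ (hpos x hx)
  have hVe : Vf P μ ρs r a b ρ ρx v = (1 / 2) * I2 + (1 / 2) * (v b - kf μ ρs (ρ b)) ^ 2
    + (1 / 2) * (v a + kf μ ρs (ρ a)) ^ 2 + Uf P ρs a b ρ +
      r * ((v a) ^ 2 / 2 + (v b) ^ 2 / 2 + (1 / 2) * I1 + Uf P ρs a b ρ) := rfl
  set U := Uf P ρs a b ρ with hUdef
  rw [hVe] at hV
  have q1 := sq_nonneg (v b - kf μ ρs (ρ b))
  have q2 := sq_nonneg (v a + kf μ ρs (ρ a))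
  have q3 := mul_nonneg hr.le (sq_nonneg (v a))
  have q4 := mul_nonneg hr.le (sq_nonneg (v b))
  have q5 := mul_nonneg hr.le hE0
  have q6 := mul_nonneg hr.le hU0
  have b1 : I2 ≤ 2 * S := by linarith
  have b2 : I1 ≤ 2 * (S / r) := by
    have : r * I1 ≤ 2 * S := by linarith
    rw [← mul_div_assoc, le_div_iff₀ hr]; linarith
  have b3 : (v a) ^ 2 ≤ 2 * (S / r) := by
    have : r * (v a) ^ 2 ≤ 2 * S := by linarith
    rw [← mul_div_assoc, le_div_iff₀ hr]; linarith
  have b4 : (v a + kf μ ρs (ρ a)) ^ 2 ≤ 2 * S := by linarith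
  have b5 : U ≤ S := by linarith
  have hCb : (J + U) / 2 ≤ C := by rw [hC]; linarith
  have osc : ∀ y ∈ Icc a b, ∀ z ∈ Icc a b, |Gf P μ ρs (ρ z) - Gf P μ ρs (ρ y)| ≤ C := by
    intro y hy z hz
    rw [chain_aux hab.le hc hpos h hGd hgc hy hz]
    have hgρ : ContinuousOn (fun x => g (ρ x)) (uIcc a b) := by
      rw [hu]; exact hgc.comp hc fun x hx => hpos x hx
    have ig : IntervalIntegrable (fun x => g (ρ x) * ρx x) volume a b := h.1.continuousOn_mul hgρ
    have hsub : uIoc y z ⊆ uIoc a b := by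
      apply uIoc_subset_uIoc_of_uIcc_subset_uIcc
      rw [hu]; exact OrdConnected.uIcc_subset ordConnected_Icc hy hz
    refine (intervalIntegral.norm_integral_le_integral_norm_uIoc (f := fun x => g (ρ x) * ρx x)).trans ?_
    have ign := (intervalIntegrable_iff.1 ig).norm
    refine (setIntegral_mono_set ign (Eventually.of_forall fun _ => norm_nonneg _)
      hsub.eventuallyLE).trans ?_
    rw [uIoc_of_le hab.le, ← intervalIntegral.integral_of_le hab.le]
    refine le_trans ?_ hCb
    have e : (J + U) / 2 = ∫ x in a..b, (1 / 2 : ℝ) *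
        ((ρ x)⁻¹ * (μ (ρ x) * (ρ x)⁻¹ * ρx x) ^ 2 + Qf P ρs (ρ x)) := by
      rw [intervalIntegral.integral_const_mul, intervalIntegral.integral_add iJ iU]
      change (J + U) / 2 = 1 / 2 * (J + U)
      ring
    rw [e]
    apply intervalIntegral.integral_mono_on hab.le ig.norm ((iJ.add iU).const_mul _)
    intro t ht
    have hp := hpos t ht
    have hs2 := Real.sq_sqrt (hQ0 _ hp)
    have hrp : (ρ t ^ ((3 : ℝ) / 2)) ^ 2 = ρ t ^ 3 := by
      rw [← Real.rpow_natCast, ← Real.rpow_mul hp.le, ← Real.rpow_natCast]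
      norm_num
    have hrp0 : 0 < ρ t ^ ((3 : ℝ) / 2) := Real.rpow_pos_of_pos hp _
    rw [Real.norm_eq_abs]
    set s := Real.sqrt (Qf P ρs (ρ t)) with hsdef
    set w := μ (ρ t) / ρ t ^ ((3 : ℝ) / 2) * ρx t with hw
    have e1 : g (ρ t) * ρx t = w * s := by simp only [hg, hw]; ring
    have e2 : (ρ t)⁻¹ * (μ (ρ t) * (ρ t)⁻¹ * ρx t) ^ 2 = w ^ 2 := by
      rw [hw, mul_pow (μ (ρ t) / _), div_pow, hrp]; field_simp
    rw [e1, e2, ← hs2, abs_le]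
    have f1 := sq_nonneg (w + s)
    have f2 := sq_nonneg (w - s)
    clear_value w s
    constructor <;> linarith
  have ha : a ∈ Icc a b := ⟨le_rfl, hab.le⟩
  have hka : kf μ ρs (ρ a) ≤ 1 + 4 * S + 4 * (S / r) := by
    have e1 := sq_nonneg (2 * v a + kf μ ρs (ρ a))
    have e2 := sq_nonneg (kf μ ρs (ρ a) - 1)
    have e3 := sq_nonneg (kf μ ρs (ρ a))
    linarith
  have hρa : ρ a ≤ max M0 ρs := by
    by_contra! hcon
    have := hM0 (ρ a) ((le_max_left _ _).trans hcon.le)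
    linarith
  constructor
  · -- lower bound
    have hex : ∃ y ∈ Icc a b, Hf P ρs (ρ y) ≤ S + 1 := by
      by_contra! hcon
      have iρ : IntervalIntegrable ρ volume a b := by
        apply ContinuousOn.intervalIntegrable; rwa [hu]
      have : ∫ x in a..b, (S + 1) * ρ x ≤ U := by
        apply intervalIntegral.integral_mono_on hab.le (iρ.const_mul _) iU
        intro t ht
        rw [Qf_eq hPc hs (hpos t ht)]
        have := mul_le_mul_of_nonneg_left (hcon t ht).le (hpos t ht).le
        linarith
      rw [intervalIntegral.integral_const_mul, hmass] at this
      linarith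
    obtain ⟨y, hy, hyH⟩ := hex
    have h1 := hεH _ (hpos y hy) hyH
    have h2 := hGm (show ε ∈ Ioi 0 from hε) (hpos y hy) h1
    have h3 := (abs_le.1 (osc y hy x hx)).1
    by_contra! hcon
    have h4 := hm (y := ρ x) (by
      rw [Real.dist_eq, sub_zero, abs_of_pos (hpos x hx)]
      exact hcon.trans_le (min_le_left _ _)) (hpos x hx)
    linarith
  · have h2 := hGm (hpos a ha) (show max M0 ρs ∈ Ioi 0 from lt_of_lt_of_le hs (le_max_right _ _)) hρa
    have h3 := (abs_le.1 (osc a ha x hx)).2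
    by_contra! hcon
    have h4 := hM (ρ x) ((le_max_left _ _).trans hcon.le)
    linarith

lemma final_aux {c C R r ℓ k1 k2 k3 I2 I1 J Nv Nρ D1 D2 mn U va vb ka kb pa pb ya yb : ℝ}
    (hc : 0 < c) (hC : 0 < C) (hR : 0 < R) (hr : 0 < r) (hℓ : 0 < ℓ)
    (hk1 : k1 = 2 * R⁻¹ + 4 * C * c⁻¹) (hk2 : k2 = 2 * k1 + 2 * ℓ * (r⁻¹ * c⁻¹))
    (hk3 : k3 = ℓ * (C * (4 * c⁻¹ + 2 * ℓ * C * c⁻¹)))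
    (hI : I2 ≤ 2 * J + 2 * I1) (hI1 : 0 ≤ I1) (hJ : 0 ≤ J) (hNv : 0 ≤ Nv) (hmn0 : 0 ≤ mn)
    (g1 : c * J ≤ D1) (g2 : c * Nv ≤ D2) (g3 : Nρ ≤ C * J)
    (g6 : I1 ≤ 2 * va ^ 2 + 2 * (ℓ * Nv))
    (g7 : U ≤ ℓ * (C * (2 * ya ^ 2 + 2 * (ℓ * Nρ))))
    (g8 : vb ^ 2 ≤ 2 * va ^ 2 + 2 * (ℓ * Nv))
    (hka : ka ^ 2 ≤ C * ya ^ 2) (hkb : kb ^ 2 ≤ C * yb ^ 2)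
    (da : c * ya ^ 2 ≤ ka * pa) (db : c * yb ^ 2 ≤ kb * pb)
    (hmn : va ^ 2 ≤ 2 * mn + 2 * ka ^ 2) :
    (1 / 2) * I2 + (1 / 2) * (vb - kb) ^ 2 + (1 / 2) * (va + ka) ^ 2 + U +
      r * (va ^ 2 / 2 + vb ^ 2 / 2 + (1 / 2) * I1 + U) ≤
    (c⁻¹ + k2 + k2 + C * c⁻¹ + k1 + 2 * C * c⁻¹ + k3 + r * (k1 + k2 + k2 + k3)) * D1
    + (c⁻¹ + k2 + k2 + C * c⁻¹ + k1 + 2 * C * c⁻¹ + k3 + r * (k1 + k2 + k2 + k3)) * r * D2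
    + (c⁻¹ + k2 + k2 + C * c⁻¹ + k1 + 2 * C * c⁻¹ + k3 + r * (k1 + k2 + k2 + k3)) * R * mn
    + (c⁻¹ + k2 + k2 + C * c⁻¹ + k1 + 2 * C * c⁻¹ + k3 + r * (k1 + k2 + k2 + k3)) * kb * pb
    + (c⁻¹ + k2 + k2 + C * c⁻¹ + k1 + 2 * C * c⁻¹ + k3 + r * (k1 + k2 + k2 + k3)) / 2
      * ka * pa := by
  set D := D1 + r * D2 + R * mn + kb * pb + ka * pa / 2 with hD
  have n1 : 0 ≤ D1 := le_trans (by positivity) g1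
  have n2 : 0 ≤ r * D2 := mul_nonneg hr.le (le_trans (by positivity) g2)
  have n3 : 0 ≤ R * mn := by positivity
  have n4 : 0 ≤ kb * pb := le_trans (by positivity) db
  have n5 : 0 ≤ ka * pa := le_trans (by positivity) da
  have hD0 : 0 ≤ D := by positivity
  have dv : ∀ {s x y : ℝ}, 0 < s → s * x ≤ y → x ≤ s⁻¹ * y := by
    intro s x y hs h
    rw [inv_mul_eq_div, le_div_iff₀ hs]; linarith
  have j1 : J ≤ c⁻¹ * D := dv hc (by linarith)
  have j2 : ya ^ 2 ≤ 2 * (c⁻¹ * D) := by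
    have := dv (y := 2 * D) hc (show c * ya ^ 2 ≤ 2 * D by linarith)
    linarith
  have j3 : yb ^ 2 ≤ c⁻¹ * D := dv hc (by linarith)
  have j4 : mn ≤ R⁻¹ * D := dv hR (by linarith)
  have j5 : Nv ≤ r⁻¹ * (c⁻¹ * D) := by
    have h1 : r * (c * Nv) ≤ D := (mul_le_mul_of_nonneg_left g2 hr.le).trans (by linarith)
    have h2 := dv hr h1
    have h3 := dv hc h2
    linarith
  have a1 : ka ^ 2 ≤ 2 * C * c⁻¹ * D := by
    have := mul_le_mul_of_nonneg_left j2 hC.le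
    linarith
  have a2 : kb ^ 2 ≤ C * c⁻¹ * D := by
    have := mul_le_mul_of_nonneg_left j3 hC.le
    linarith
  have a3 : va ^ 2 ≤ k1 * D := by rw [hk1]; linarith
  have a4 : 2 * va ^ 2 + 2 * (ℓ * Nv) ≤ k2 * D := by
    have := mul_le_mul_of_nonneg_left j5 hℓ.le
    rw [hk2]; linarith
  have a5 : U ≤ k3 * D := by
    have h1 : Nρ ≤ C * (c⁻¹ * D) := g3.trans (mul_le_mul_of_nonneg_left j1 hC.le)
    have h2 : 2 * ya ^ 2 + 2 * (ℓ * Nρ) ≤ 2 * (2 * (c⁻¹ * D)) + 2 * (ℓ * (C * (c⁻¹ * D))) := by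
      gcongr
    have h3 : U ≤ ℓ * (C * (2 * (2 * (c⁻¹ * D)) + 2 * (ℓ * (C * (c⁻¹ * D))))) :=
      g7.trans (by gcongr)
    rw [hk3]; linarith
  have a6 : I1 ≤ k2 * D := g6.trans a4
  have a7 : vb ^ 2 ≤ k2 * D := g8.trans a4
  have hk10 : 0 ≤ k1 := by rw [hk1]; positivity
  have hk20 : 0 ≤ k2 := by rw [hk2]; positivity
  have a8 : va ^ 2 / 2 + vb ^ 2 / 2 + (1 / 2) * I1 + U ≤ (k1 + k2 + k2 + k3) * D := by
    have p1 := mul_nonneg hk10 hD0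
    have p2 := mul_nonneg hk20 hD0
    linarith
  have a9 := mul_le_mul_of_nonneg_left a8 hr.le
  have s1 := sq_nonneg (vb + kb)
  have s2 := sq_nonneg (va - ka)
  have fin : (1 / 2) * I2 + (1 / 2) * (vb - kb) ^ 2 + (1 / 2) * (va + ka) ^ 2 + U +
      r * (va ^ 2 / 2 + vb ^ 2 / 2 + (1 / 2) * I1 + U) ≤
      (c⁻¹ + k2 + k2 + C * c⁻¹ + k1 + 2 * C * c⁻¹ + k3 + r * (k1 + k2 + k2 + k3)) * D := by
    linarith
  refine fin.trans (le_of_eq ?_)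
  rw [hD]; ring

set_option maxHeartbeats 1000000 in
/-- **Lemma 3 of the paper.**  Under Assumption (H), given `S ≥ 0` and `R, r > 0`,
there is `L > 0` such that every static configuration `(a, b, ρ, v)` with
`ρ, v ∈ H¹(a,b)`, unit total mass and `V(a,b,ρ,v) ≤ S` satisfies the dissipation
estimate (3.25). -/
theorem CLF_dissipation_estimate
    (P μ P' : ℝ → ℝ) (Pext ρs : ℝ)
    (hP : ContDiffOn ℝ 2 P (Ioi 0)) (hμ : ContDiffOn ℝ 2 μ (Ioi 0))
    (hPpos : ∀ x, 0 < x → 0 < P x) (hμpos : ∀ x, 0 < x → 0 < μ x)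
    (hP' : ∀ x, 0 < x → HasDerivAt P (P' x) x)
    (hP'pos : ∀ x, 0 < x → 0 < P' x)
    (hPrange : P '' Ioi 0 = Ioi 0)
    (hPext : 0 < Pext) (hρs : 0 < ρs) (hPρs : P ρs = Pext)
    (hH : AssumpH P μ ρs)
    (S R r : ℝ) (hS : 0 ≤ S) (hR : 0 < R) (hr : 0 < r) :
    ∃ L : ℝ, 0 < L ∧
      ∀ (a b : ℝ) (ρ ρx v vx : ℝ → ℝ), a < b →
        ContinuousOn ρ (Icc a b) → (∀ x ∈ Icc a b, 0 < ρ x) →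
        H1On a b ρ ρx →
        ContinuousOn v (Icc a b) → H1On a b v vx →
        (∫ x in a..b, ρ x) = 1 →
        Vf P μ ρs r a b ρ ρx v ≤ S →
        Vf P μ ρs r a b ρ ρx v ≤
          L * (∫ x in a..b, P' (ρ x) * (μ (ρ x) * (ρ x)⁻¹ * ρx x) ^ 2)
          + L * r * (∫ x in a..b, μ (ρ x) * (vx x) ^ 2)
          + L * R * min (((r + 1) * v a + kf μ ρs (ρ a)) ^ 2) ((v a) ^ 2)
          + L * kf μ ρs (ρ b) * (P (ρ b) - Pext)
          + L / 2 * kf μ ρs (ρ a) * (P (ρ a) - Pext) := by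
  have hPc : ContinuousOn P (Ioi 0) := hP.continuousOn
  have hμc : ContinuousOn μ (Ioi 0) := hμ.continuousOn
  have hP'c : ContinuousOn P' (Ioi 0) := by
    have h1 := hP.continuousOn_deriv_of_isOpen isOpen_Ioi (by norm_num)
    exact h1.congr fun x hx => (hP' x hx).deriv.symm
  have hPm : StrictMonoOn P (Ioi 0) := by
    apply strictMonoOn_of_deriv_pos (convex_Ioi 0) hPc
    intro x hx
    rw [interior_Ioi] at hx
    rw [(hP' x hx).deriv]; exact hP'pos x hx
  obtain ⟨m, M, hm, hms, hMs, hrange⟩ := range_aux hPc hPm hμc hμpos hρs hH S r hr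
  obtain ⟨c, C, hc0, hC0, hpt⟩ :=
    pointwise_aux hPc hP'c hμc hμpos hP' hP'pos hm hms hMs
  set ℓ := m⁻¹ with hℓ
  have hℓ0 : 0 < ℓ := by positivity
  set k1 := 2 * R⁻¹ + 4 * C * c⁻¹ with hk1
  set k2 := 2 * k1 + 2 * ℓ * (r⁻¹ * c⁻¹) with hk2
  set k3 := ℓ * (C * (4 * c⁻¹ + 2 * ℓ * C * c⁻¹)) with hk3
  have hk10 : 0 < k1 := by positivity
  have hk20 : 0 < k2 := by positivity
  have hk30 : 0 < k3 := by positivity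
  refine ⟨c⁻¹ + k2 + k2 + C * c⁻¹ + k1 + 2 * C * c⁻¹ + k3 + r * (k1 + k2 + k2 + k3),
    by positivity, ?_⟩
  intro a b ρ ρx v vx hab hc hpos h hv hvx hmass hV
  have hrg := hrange a b ρ ρx v hab hc hpos h hv hmass hV
  obtain ⟨iJ, iE, hJ, hI, hJ0, hE0, hI0⟩ := ints_aux hab hμc hc hpos h hv
  have hu : uIcc a b = Icc a b := uIcc_of_le hab.le
  have ha : a ∈ Icc a b := ⟨le_rfl, hab.le⟩
  have hb : b ∈ Icc a b := ⟨hab.le, le_rfl⟩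
  have iρ : IntervalIntegrable ρ volume a b := by
    apply ContinuousOn.intervalIntegrable; rwa [hu]
  have hlen : b - a ≤ ℓ := by
    have h1 : ∫ x in a..b, m ≤ ∫ x in a..b, ρ x :=
      intervalIntegral.integral_mono_on hab.le (by simp) iρ fun x hx => (hrg x hx).1
    rw [hmass, intervalIntegral.integral_const, smul_eq_mul] at h1
    rw [hℓ, ← one_div, le_div_iff₀ hm]; exact h1
  have hcomp : ∀ f : ℝ → ℝ, ContinuousOn f (Ioi 0) → ContinuousOn (fun x => f (ρ x)) (Icc a b) :=
    fun f hf => hf.comp hc fun x hx => hpos x hx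
  have hinv : ContinuousOn (fun x => (ρ x)⁻¹) (Icc a b) := hc.inv₀ fun x hx => (hpos x hx).ne'
  have iD1 : IntervalIntegrable (fun x => P' (ρ x) * (μ (ρ x) * (ρ x)⁻¹ * ρx x) ^ 2)
      volume a b := by
    have hk : ContinuousOn (fun x => P' (ρ x) * (μ (ρ x) * (ρ x)⁻¹) ^ 2) (uIcc a b) := by
      rw [hu]; exact (hcomp _ hP'c).mul (((hcomp _ hμc).mul hinv).pow 2)
    refine (h.2.1.continuousOn_mul hk).congr (fun x hx => ?_)
    ring
  have iD2 : IntervalIntegrable (fun x => μ (ρ x) * (vx x) ^ 2) volume a b :=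
    hvx.2.1.continuousOn_mul (by rw [hu]; exact hcomp _ hμc)
  have iU : IntervalIntegrable (fun x => Qf P ρs (ρ x)) volume a b := by
    apply ContinuousOn.intervalIntegrable
    rw [hu]; exact hcomp _ (Qf_cont hPc hρs)
  have hVe : Vf P μ ρs r a b ρ ρx v = (1 / 2) *
      (∫ x in a..b, (ρ x)⁻¹ * (ρ x * v x + μ (ρ x) * (ρ x)⁻¹ * ρx x) ^ 2)
      + (1 / 2) * (v b - kf μ ρs (ρ b)) ^ 2
      + (1 / 2) * (v a + kf μ ρs (ρ a)) ^ 2 + Uf P ρs a b ρ +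
      r * ((v a) ^ 2 / 2 + (v b) ^ 2 / 2 + (1 / 2) * (∫ x in a..b, ρ x * (v x) ^ 2)
        + Uf P ρs a b ρ) := rfl
  rw [hVe]
  clear hVe hV
  have g1 : c * (∫ x in a..b, (ρ x)⁻¹ * (μ (ρ x) * (ρ x)⁻¹ * ρx x) ^ 2) ≤
      ∫ x in a..b, P' (ρ x) * (μ (ρ x) * (ρ x)⁻¹ * ρx x) ^ 2 := by
    rw [← intervalIntegral.integral_const_mul]
    apply intervalIntegral.integral_mono_on hab.le (iJ.const_mul _) iD1
    intro x hx
    rw [← mul_assoc]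
    exact mul_le_mul_of_nonneg_right (hpt _ (hrg x hx)).1 (sq_nonneg _)
  have g2 : c * (∫ x in a..b, (vx x) ^ 2) ≤ ∫ x in a..b, μ (ρ x) * (vx x) ^ 2 := by
    rw [← intervalIntegral.integral_const_mul]
    apply intervalIntegral.integral_mono_on hab.le (hvx.2.1.const_mul _) iD2
    intro x hx
    exact mul_le_mul_of_nonneg_right (hpt _ (hrg x hx)).2.1 (sq_nonneg _)
  have g3 : (∫ x in a..b, (ρx x) ^ 2) ≤
      C * (∫ x in a..b, (ρ x)⁻¹ * (μ (ρ x) * (ρ x)⁻¹ * ρx x) ^ 2) := by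
    rw [← intervalIntegral.integral_const_mul]
    apply intervalIntegral.integral_mono_on hab.le h.2.1 (iJ.const_mul _)
    intro x hx
    have := mul_le_mul_of_nonneg_right (hpt _ (hrg x hx)).2.2.2.2.2 (sq_nonneg (ρx x))
    linarith
  have hNv0 : 0 ≤ ∫ x in a..b, (vx x) ^ 2 :=
    intervalIntegral.integral_nonneg hab.le fun s _ => sq_nonneg _
  have hNρ0 : 0 ≤ ∫ x in a..b, (ρx x) ^ 2 :=
    intervalIntegral.integral_nonneg hab.le fun s _ => sq_nonneg _
  have g4 : ∀ x ∈ Icc a b, (v x) ^ 2 ≤ 2 * (v a) ^ 2 + 2 * (ℓ * ∫ x in a..b, (vx x) ^ 2) := by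
    intro x hx
    have e1 := cs_aux hab hvx hx
    have e2 := mul_le_mul_of_nonneg_right hlen hNv0
    have e3 := sq_nonneg (v x - 2 * v a)
    linarith
  have g5 : ∀ x ∈ Icc a b, (ρ x - ρs) ^ 2 ≤ 2 * (ρ a - ρs) ^ 2 +
      2 * (ℓ * ∫ x in a..b, (ρx x) ^ 2) := by
    intro x hx
    have e1 := cs_aux hab h hx
    have e2 := mul_le_mul_of_nonneg_right hlen hNρ0
    have e3 := sq_nonneg ((ρ x - ρs) - 2 * (ρ a - ρs))
    linarith
  have g6 : (∫ x in a..b, ρ x * (v x) ^ 2) ≤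
      2 * (v a) ^ 2 + 2 * (ℓ * ∫ x in a..b, (vx x) ^ 2) := by
    have e : ∫ x in a..b, (2 * (v a) ^ 2 + 2 * (ℓ * ∫ x in a..b, (vx x) ^ 2)) * ρ x =
      2 * (v a) ^ 2 + 2 * (ℓ * ∫ x in a..b, (vx x) ^ 2) := by
      rw [intervalIntegral.integral_const_mul, hmass, mul_one]
    rw [← e]
    apply intervalIntegral.integral_mono_on hab.le iE (iρ.const_mul _)
    intro x hx
    rw [mul_comm]
    exact mul_le_mul_of_nonneg_right (g4 x hx) (hpos x hx).le
  have g7 : Uf P ρs a b ρ ≤ ℓ * (C * (2 * (ρ a - ρs) ^ 2 +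
      2 * (ℓ * ∫ x in a..b, (ρx x) ^ 2))) := by
    have e : Uf P ρs a b ρ ≤ ∫ x in a..b, (C * (2 * (ρ a - ρs) ^ 2 +
      2 * (ℓ * ∫ x in a..b, (ρx x) ^ 2))) := by
      apply intervalIntegral.integral_mono_on hab.le iU (by simp)
      intro x hx
      exact (hpt _ (hrg x hx)).2.2.2.2.1.trans (mul_le_mul_of_nonneg_left (g5 x hx) hC0.le)
    refine e.trans ?_
    rw [intervalIntegral.integral_const, smul_eq_mul]
    exact mul_le_mul_of_nonneg_right hlen (by positivity)
  have g8 := g4 b hb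
  obtain ⟨-, -, ka, da, -, -⟩ := hpt _ (hrg a ha)
  obtain ⟨-, -, kb, db, -, -⟩ := hpt _ (hrg b hb)
  rw [hPρs] at da db
  clear hpt hrg hrange g4 g5 iJ iE iρ iU iD1 iD2 hcomp hinv hJ h hvx
  have hmn : (v a) ^ 2 ≤ 2 * min (((r + 1) * v a + kf μ ρs (ρ a)) ^ 2) ((v a) ^ 2) +
      2 * kf μ ρs (ρ a) ^ 2 := by
    rcases min_choice (((r + 1) * v a + kf μ ρs (ρ a)) ^ 2) ((v a) ^ 2) with e | e
    · rw [e]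
      generalize kf μ ρs (ρ a) = k
      have e1 : (v a) ^ 2 ≤ ((r + 1) * v a) ^ 2 := by
        have : 0 ≤ (r ^ 2 + 2 * r) * (v a) ^ 2 := by positivity
        linarith
      have e3 := sq_nonneg ((r + 1) * v a + 2 * k)
      linarith
    · rw [e]
      have e1 := sq_nonneg (v a)
      have e2 := sq_nonneg (kf μ ρs (ρ a))
      linarith
  have hmn0 : 0 ≤ min (((r + 1) * v a + kf μ ρs (ρ a)) ^ 2) ((v a) ^ 2) :=
    le_min (sq_nonneg _) (sq_nonneg _)
  refine final_aux hc0 hC0 hR hr hℓ0 hk1 hk2 hk3 hI hE0 hJ0 hNv0 hmn0 g1 g2 g3 g6 g7 g8 ka kb da db hmn
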